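/- (Theorem 1) Let G be a quasi-strongly connected directed graph on {1,…,N} with self-loops and radius r. Consider the masked self-attention dynamics without LayerNorm: X^{(t+1)} = A^{(t)} X^{(t)} W_V^{(t)} with X^{(0)} ∈ ℝ^{N×d}, where A^{(t)} is the masked-softmax attention matrix of X^{(t)} over G with weight matrices W_Q^{(t)}, W_K^{(t)} ∈ ℝ^{d×d}. Assume there is a constant C₀ with max(‖W_Q^{(t)}‖₂, ‖W_K^{(t)}‖₂) ≤ C₀ for all t, and that the sequence {‖W_V^{(0)} W_V^{(1)} ⋯ W_V^{(k)}‖₂}_{k≥0} is bounded. Then: (i) there exists ε > 0 such that A^{(t)}_{ij} ≥ ε for all t ≥ 0 and all (j,i) ∈ E(G); and (ii) there exists C > 0 such that μ(X^{(t)}) ≤ C (1 − ε^r)^{t/r} for all t ≥ 0, so the tokens converge exponentially to a common vector. -/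

import Mathlib

/-- Directed paths of length exactly `m` in the graph with edge relation `E`
(`E a b` means there is a directed edge from `a` to `b`). -/
def relPow {N : ℕ} (E : Fin N → Fin N → Prop) : ℕ → Fin N → Fin N → Prop
  | 0 => fun u v => u = v
  | m + 1 => fun u v => ∃ c, E u c ∧ relPow E m c v

/-- The Frobenius norm of a real matrix. -/
noncomputable def frobNorm {N d : ℕ} (M : Matrix (Fin N) (Fin d) ℝ) : ℝ :=
  Real.sqrt (∑ i, ∑ j, (M i j) ^ 2)

/-- The token-similarity measure `μ(X) = ‖X - 𝟙 (𝟙ᵀ X / N)‖_F`. -/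
noncomputable def muMeasure {N d : ℕ} (X : Matrix (Fin N) (Fin d) ℝ) : ℝ :=
  frobNorm (X - Matrix.of fun _ j => (∑ k, X k j) / N)

/-- The spectral (operator `2`-) norm of a real matrix. -/
noncomputable def specNorm {n m : ℕ} (M : Matrix (Fin n) (Fin m) ℝ) : ℝ :=
  ‖LinearMap.toContinuousLinearMap (Matrix.toEuclideanLin M)‖

/-- The masked-softmax attention matrix over the graph with edge relation `E`
(`E j i` means token `i` may attend to token `j`), given raw scores `R`. -/
noncomputable def maskedAttn {N : ℕ} (E : Fin N → Fin N → Prop) [DecidableRel E]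
    (R : Matrix (Fin N) (Fin N) ℝ) : Matrix (Fin N) (Fin N) ℝ :=
  Matrix.of fun i j =>
    if E j i then
      Real.exp (R i j) / ∑ k ∈ Finset.univ.filter (fun k => E k i), Real.exp (R i k)
    else 0

theorem abs_apply_le_specNorm {n m : ℕ} (M : Matrix (Fin n) (Fin m) ℝ) (i : Fin n) (j : Fin m) :
    |M i j| ≤ specNorm M := by
  have h := (LinearMap.toContinuousLinearMap (Matrix.toEuclideanLin M)).le_opNorm
    (EuclideanSpace.single j 1)
  have h2 := PiLp.norm_apply_le
    ((LinearMap.toContinuousLinearMap (Matrix.toEuclideanLin M)) (EuclideanSpace.single j 1)) i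
  have h3 := h2.trans h
  simpa [specNorm, Matrix.toLpLin_apply] using h3

theorem abs_mul_apply_le {l m n : ℕ} {P : Matrix (Fin l) (Fin m) ℝ} {Q : Matrix (Fin m) (Fin n) ℝ}
    {a b : ℝ} (hP : ∀ i j, |P i j| ≤ a) (hQ : ∀ i j, |Q i j| ≤ b) (i : Fin l) (j : Fin n) :
    |(P * Q) i j| ≤ m * (a * b) := by
  rw [Matrix.mul_apply]
  calc |∑ k, P i k * Q k j| ≤ ∑ k, |P i k * Q k j| := Finset.abs_sum_le_sum_abs _ _
    _ ≤ ∑ _k : Fin m, a * b := by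
        refine Finset.sum_le_sum fun k _ => ?_
        rw [abs_mul]
        exact mul_le_mul (hP i k) (hQ k j) (abs_nonneg _) ((abs_nonneg _).trans (hP i k))
    _ = m * (a * b) := by simp

theorem muMeasure_le {N d : ℕ} (hN : 0 < N) (X : Matrix (Fin N) (Fin d) ℝ) {s : ℝ} (hs : 0 ≤ s)
    (h : ∀ i i' k, |X i k - X i' k| ≤ s) : muMeasure X ≤ √(N * d) * s := by
  have hN' : (0 : ℝ) < N := by exact_mod_cast hN
  have entry : ∀ i k, (X i k - (∑ l, X l k) / N) ^ 2 ≤ s ^ 2 := by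
    intro i k
    have e : X i k - (∑ l, X l k) / N = (∑ l, (X i k - X l k)) / N := by
      rw [Finset.sum_sub_distrib]
      simp
      field_simp
    refine sq_le_sq' ?_ ?_ <;> rw [e]
    · rw [le_div_iff₀ hN']
      calc -s * N = ∑ _l : Fin N, -s := by simp [mul_comm]
        _ ≤ _ := Finset.sum_le_sum fun l _ => (abs_le.1 (h i l k)).1
    · rw [div_le_iff₀ hN']
      calc _ ≤ ∑ _l : Fin N, s := Finset.sum_le_sum fun l _ => (abs_le.1 (h i l k)).2
        _ = s * N := by simp [mul_comm]
  unfold muMeasure frobNorm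
  rw [← Real.sqrt_sq hs, ← Real.sqrt_mul (by positivity)]
  refine Real.sqrt_le_sqrt ?_
  calc _ ≤ ∑ _i : Fin N, ∑ _k : Fin d, s ^ 2 :=
        Finset.sum_le_sum fun i _ => Finset.sum_le_sum fun k _ => by simpa using entry i k
    _ = N * d * s ^ 2 := by simp [mul_assoc]

theorem relPow_of_le {N : ℕ} {E : Fin N → Fin N → Prop} (hloop : ∀ i, E i i) {m n : ℕ}
    (hmn : m ≤ n) {u v : Fin N} (h : relPow E m u v) : relPow E n u v := by
  induction hmn with
  | refl => exact h
  | step _ ih => exact ⟨u, hloop u, ih⟩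

theorem maskedAttn_nonneg {N : ℕ} (E : Fin N → Fin N → Prop) [DecidableRel E]
    (R : Matrix (Fin N) (Fin N) ℝ) (i j : Fin N) : 0 ≤ maskedAttn E R i j := by
  simp only [maskedAttn, Matrix.of_apply]
  split_ifs <;> positivity

theorem sum_maskedAttn {N : ℕ} (E : Fin N → Fin N → Prop) [DecidableRel E]
    (hloop : ∀ i, E i i) (R : Matrix (Fin N) (Fin N) ℝ) (i : Fin N) :
    ∑ j, maskedAttn E R i j = 1 := by
  simp only [maskedAttn, Matrix.of_apply]
  rw [← Finset.sum_filter, ← Finset.sum_div]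
  exact div_self (Finset.sum_pos (fun _ _ => Real.exp_pos _) ⟨i, by simp [hloop i]⟩).ne'

theorem le_maskedAttn {N : ℕ} (E : Fin N → Fin N → Prop) [DecidableRel E]
    (hloop : ∀ i, E i i) (R : Matrix (Fin N) (Fin N) ℝ) {S : ℝ} (hR : ∀ i j, |R i j| ≤ S)
    {i j : Fin N} (hij : E j i) :
    Real.exp (-S) / (N * Real.exp S) ≤ maskedAttn E R i j := by
  simp only [maskedAttn, Matrix.of_apply, if_pos hij]
  refine div_le_div₀ (Real.exp_pos _).le (Real.exp_le_exp.2 (abs_le.1 (hR i j)).1)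
    (Finset.sum_pos (fun _ _ => Real.exp_pos _) ⟨i, by simp [hloop i]⟩) ?_
  calc _ ≤ ∑ k, Real.exp (R i k) :=
        Finset.sum_le_sum_of_subset_of_nonneg (Finset.filter_subset _ _)
          fun _ _ _ => (Real.exp_pos _).le
    _ ≤ ∑ _k : Fin N, Real.exp S :=
        Finset.sum_le_sum fun k _ => Real.exp_le_exp.2 (abs_le.1 (hR i k)).2
    _ = N * Real.exp S := by simp

/-- All values of `y` lie in a common interval of length `s`. -/
def InBand {N : ℕ} (y : Fin N → ℝ) (s : ℝ) : Prop :=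
  ∃ a, ∀ i, a ≤ y i ∧ y i ≤ a + s

theorem InBand.abs_sub_le {N : ℕ} {y : Fin N → ℝ} {s : ℝ} (h : InBand y s) (i j : Fin N) :
    |y i - y j| ≤ s := by
  obtain ⟨a, ha⟩ := h
  rw [abs_le]
  constructor <;> linarith [ha i, ha j]

/-- A nonnegative initial value at `v` propagates along a path of length `m` under `m` steps of a
nonnegative linear recursion, losing at most a factor `ε` per step. -/
theorem pow_mul_le_of_relPow {N : ℕ} {E : Fin N → Fin N → Prop}
    {A : ℕ → Matrix (Fin N) (Fin N) ℝ} {ε : ℝ} (hε : 0 ≤ ε) (hA0 : ∀ t i j, 0 ≤ A t i j)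
    (hAε : ∀ t i j, E j i → ε ≤ A t i j) {z : ℕ → Fin N → ℝ}
    (hz : ∀ t i, z (t + 1) i = ∑ k, A t i k * z t k) {m : ℕ} :
    ∀ {t : ℕ} {v u : Fin N}, (∀ i, 0 ≤ z t i) → relPow E m v u →
      ε ^ m * z t v ≤ z (t + m) u := by
  induction m with
  | zero =>
    intro t v u _ h
    have h : v = u := h
    simp [h]
  | succ m ih =>
    intro t v u h0 ⟨c, hvc, hcu⟩
    have h0' : ∀ i, 0 ≤ z (t + 1) i := fun i => by
      rw [hz]
      exact Finset.sum_nonneg fun k _ => mul_nonneg (hA0 t i k) (h0 k)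
    have hc : ε * z t v ≤ z (t + 1) c := by
      rw [hz]
      exact (mul_le_mul_of_nonneg_right (hAε t c v hvc) (h0 v)).trans
        (Finset.single_le_sum (f := fun k => A t c k * z t k)
          (fun k _ => mul_nonneg (hA0 t c k) (h0 k)) (Finset.mem_univ v))
    calc ε ^ (m + 1) * z t v = ε ^ m * (ε * z t v) := by ring
      _ ≤ ε ^ m * z (t + 1) c := mul_le_mul_of_nonneg_left hc (pow_nonneg hε m)
      _ ≤ z (t + 1 + m) u := ih h0' hcu
      _ = z (t + (m + 1)) u := by rw [add_assoc, add_comm 1 m]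

/-- If every node is reached from `v` by a path of length `m`, then `m` averaging steps shrink the
band by the factor `1 - ε ^ m`. -/
theorem InBand.contract {N : ℕ} {E : Fin N → Fin N → Prop}
    {A : ℕ → Matrix (Fin N) (Fin N) ℝ} {ε : ℝ} (hε : 0 ≤ ε) (hA0 : ∀ t i j, 0 ≤ A t i j)
    (hA1 : ∀ t i, ∑ j, A t i j = 1)
    (hAε : ∀ t i j, E j i → ε ≤ A t i j) {y : ℕ → Fin N → ℝ}
    (hy : ∀ t i, y (t + 1) i = ∑ k, A t i k * y t k) {m t : ℕ} {v : Fin N}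
    (hv : ∀ u, relPow E m v u) {s : ℝ} (h : InBand (y t) s) :
    InBand (y (t + m)) (s * (1 - ε ^ m)) := by
  obtain ⟨a, ha⟩ := h
  refine ⟨a + ε ^ m * (y t v - a), fun u => ⟨?_, ?_⟩⟩
  · have := pow_mul_le_of_relPow (z := fun t i => y t i - a) hε hA0 hAε
      (fun t i => by simp only [mul_sub, Finset.sum_sub_distrib, ← Finset.sum_mul, hA1, hy]; ring)
      (fun i => sub_nonneg.2 (ha i).1) (hv u)
    linarith
  · have := pow_mul_le_of_relPow (z := fun t i => a + s - y t i) hε hA0 hAε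
      (fun t i => by simp only [mul_sub, Finset.sum_sub_distrib, ← Finset.sum_mul, hA1, hy]; ring)
      (fun i => sub_nonneg.2 (ha i).2) (hv u)
    linarith

theorem InBand.step {N : ℕ} {A : Matrix (Fin N) (Fin N) ℝ} (hA0 : ∀ i j, 0 ≤ A i j)
    (hA1 : ∀ i, ∑ j, A i j = 1) {y : Fin N → ℝ} {s : ℝ} (h : InBand y s) :
    InBand (fun i => ∑ k, A i k * y k) s := by
  obtain ⟨a, ha⟩ := h
  refine ⟨a, fun i => ⟨?_, ?_⟩⟩
  · calc a = ∑ k, A i k * a := by rw [← Finset.sum_mul, hA1, one_mul]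
      _ ≤ _ := Finset.sum_le_sum fun k _ => mul_le_mul_of_nonneg_left (ha k).1 (hA0 i k)
  · calc _ ≤ ∑ k, A i k * (a + s) :=
          Finset.sum_le_sum fun k _ => mul_le_mul_of_nonneg_left (ha k).2 (hA0 i k)
      _ = a + s := by rw [← Finset.sum_mul, hA1, one_mul]

theorem InBand.iterate {N : ℕ} {E : Fin N → Fin N → Prop}
    {A : ℕ → Matrix (Fin N) (Fin N) ℝ} {ε : ℝ} (hε : 0 ≤ ε) (hA0 : ∀ t i j, 0 ≤ A t i j)
    (hA1 : ∀ t i, ∑ j, A t i j = 1)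
    (hAε : ∀ t i j, E j i → ε ≤ A t i j) {y : ℕ → Fin N → ℝ}
    (hy : ∀ t i, y (t + 1) i = ∑ k, A t i k * y t k) {r : ℕ} {v : Fin N}
    (hv : ∀ u, relPow E r v u) {s : ℝ} (h : InBand (y 0) s) (t : ℕ) :
    InBand (y t) (s * (1 - ε ^ r) ^ (t / r)) := by
  have multiples : ∀ q, InBand (y (r * q)) (s * (1 - ε ^ r) ^ q) := by
    intro q
    induction q with
    | zero => simpa using h
    | succ q ih =>
      rw [pow_succ, ← mul_assoc]
      exact ih.contract hε hA0 hA1 hAε hy hv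
  have remainder : ∀ q n, InBand (y (r * q + n)) (s * (1 - ε ^ r) ^ q) := by
    intro q n
    induction n with
    | zero => exact multiples q
    | succ n ih =>
      have e : y (r * q + (n + 1)) =
          fun i => ∑ k, A (r * q + n) i k * y (r * q + n) k := funext (hy _)
      rw [e]
      exact ih.step (hA0 _) (hA1 _)
  have := remainder (t / r) (t % r)
  rwa [Nat.div_add_mod] at this

theorem one_sub_pow_div_le {ε : ℝ} (hε0 : 0 < ε) (hε1 : ε ≤ 1 / 2) (r t : ℕ) :
    (1 - ε ^ r) ^ (t / r) ≤ 2 * (1 - ε ^ r) ^ ((t : ℝ) / (r : ℝ)) := by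
  rcases Nat.eq_zero_or_pos r with rfl | hr
  · simp
  have hp : ε ^ r ≤ 1 / 2 := (pow_le_of_le_one hε0.le (by linarith) hr.ne').trans hε1
  have hp0 : 0 < ε ^ r := pow_pos hε0 r
  set b := 1 - ε ^ r with hb
  have hb0 : 0 < b := by linarith
  have hexp : (t : ℝ) / r - 1 ≤ ((t / r : ℕ) : ℝ) := by
    rw [← Nat.floor_div_eq_div (K := ℝ)]
    exact (Nat.sub_one_lt_floor _).le
  calc b ^ (t / r) = b ^ ((t / r : ℕ) : ℝ) := (Real.rpow_natCast _ _).symm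
    _ ≤ b ^ ((t : ℝ) / r - 1) :=
        Real.rpow_le_rpow_of_exponent_ge hb0 (by linarith) hexp
    _ = b ^ ((t : ℝ) / r) / b := Real.rpow_sub_one hb0.ne' _
    _ ≤ 2 * b ^ ((t : ℝ) / r) := by
        rw [div_le_iff₀ hb0]
        have := Real.rpow_nonneg hb0.le ((t : ℝ) / r)
        nlinarith

/-- **Theorem 1.** Masked self-attention without LayerNorm over a
quasi-strongly connected graph with self-loops and radius `r`: the attention weights on
edges are bounded below by some `ε > 0` and `μ(X^{(t)}) ≤ C (1-ε^r)^{t/r}`, i.e. tokens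
converge exponentially to a common vector. -/
theorem masked_attention_rank_collapse
    (N d : ℕ) (hN : 0 < N) (hd : 0 < d)
    (E : Fin N → Fin N → Prop) [DecidableRel E]
    (hloop : ∀ i, E i i)
    (hqsc : ∃ v, ∀ u, ∃ m, relPow E m v u)
    (r : ℕ)
    (hradius : IsLeast {ρ : ℕ | ∃ v, ∀ u, ∃ m ≤ ρ, relPow E m v u} r)
    (WQ WK WV : ℕ → Matrix (Fin d) (Fin d) ℝ)
    (C₀ : ℝ)
    (hQK : ∀ t, specNorm (WQ t) ≤ C₀ ∧ specNorm (WK t) ≤ C₀)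
    (hV : ∃ B : ℝ, ∀ k : ℕ, specNorm (((List.range (k + 1)).map WV).prod) ≤ B)
    (X : ℕ → Matrix (Fin N) (Fin d) ℝ)
    (A : ℕ → Matrix (Fin N) (Fin N) ℝ)
    (hA : ∀ t, A t = maskedAttn E ((Real.sqrt d)⁻¹ • (X t * WQ t * (X t * WK t).transpose)))
    (hX : ∀ t, X (t + 1) = A t * X t * WV t) :
    ∃ ε > 0, (∀ t : ℕ, ∀ i j : Fin N, E j i → ε ≤ A t i j) ∧
      ∃ C > 0, ∀ t : ℕ, muMeasure (X t) ≤ C * (1 - ε ^ r) ^ ((t : ℝ) / (r : ℝ)) := by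
  obtain ⟨v, hv⟩ := hradius.1
  replace hv : ∀ u, relPow E r v u := fun u =>
    let ⟨_, hm, h⟩ := hv u
    relPow_of_le hloop hm h
  obtain ⟨B, hB⟩ := hV
  have hA0 : ∀ t i j, 0 ≤ A t i j := fun t i j => by rw [hA]; exact maskedAttn_nonneg _ _ _ _
  have hA1 : ∀ t i, ∑ j, A t i j = 1 := fun t i => by rw [hA]; exact sum_maskedAttn _ hloop _ _
  let W : ℕ → Matrix (Fin d) (Fin d) ℝ := fun t => ((List.range t).map WV).prod
  let Y : ℕ → Matrix (Fin N) (Fin d) ℝ := fun t => Nat.rec (X 0) (fun t Z => A t * Z) t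
  have hY : ∀ t, Y (t + 1) = A t * Y t := fun t => rfl
  have hXY : ∀ t, X t = Y t * W t := by
    intro t
    induction t with
    | zero => simp [Y, W]
    | succ t ih =>
      have hW : W (t + 1) = W t * WV t := by simp [W, List.range_succ]
      rw [hX, hY, hW, ih]
      simp only [Matrix.mul_assoc]
  have hW : ∀ t j k, |W t j k| ≤ max B 1 := by
    intro t j k
    rcases t with _ | t
    · refine le_trans ?_ (le_max_right _ _)
      simp only [W, List.range_zero, List.map_nil, List.prod_nil, Matrix.one_apply]
      split_ifs <;> simp
    · exact (abs_apply_le_specNorm _ _ _).trans ((hB t).trans (le_max_left _ _))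
  obtain ⟨K, hK0, hK⟩ : ∃ K : ℝ, 0 ≤ K ∧ ∀ i j, |X 0 i j| ≤ K :=
    ⟨∑ i, ∑ j, |X 0 i j|, by positivity, fun i j =>
      (Finset.single_le_sum (f := fun j => |X 0 i j|) (fun _ _ => abs_nonneg _)
        (Finset.mem_univ j)).trans
      (Finset.single_le_sum (f := fun i => ∑ j, |X 0 i j|)
        (fun _ _ => Finset.sum_nonneg fun _ _ => abs_nonneg _) (Finset.mem_univ i))⟩
  have hYK : ∀ t i j, |Y t i j| ≤ K := by
    intro t
    induction t with
    | zero => exact hK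
    | succ t ih =>
      intro i j
      rw [hY, Matrix.mul_apply]
      calc _ ≤ ∑ k, |A t i k * Y t k j| := Finset.abs_sum_le_sum_abs _ _
        _ ≤ ∑ k, A t i k * K := Finset.sum_le_sum fun k _ => by
            rw [abs_mul, abs_of_nonneg (hA0 t i k)]
            exact mul_le_mul_of_nonneg_left (ih k j) (hA0 t i k)
        _ = K := by rw [← Finset.sum_mul, hA1, one_mul]
  obtain ⟨S, hS⟩ : ∃ S : ℝ, ∀ t i j,
      |((Real.sqrt d)⁻¹ • (X t * WQ t * (X t * WK t).transpose)) i j| ≤ S := by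
    have hXt : ∀ t i j, |X t i j| ≤ d * (K * max B 1) := fun t i j => by
      rw [hXY]
      exact abs_mul_apply_le (hYK t) (hW t) i j
    let M : ℝ := d * (K * max B 1)
    refine ⟨(Real.sqrt d)⁻¹ * (d * (d * (M * C₀) * (d * (M * C₀)))), fun t i j => ?_⟩
    rw [Matrix.smul_apply, smul_eq_mul, abs_mul, abs_of_nonneg (by positivity)]
    refine mul_le_mul_of_nonneg_left ?_ (by positivity)
    exact abs_mul_apply_le
      (abs_mul_apply_le (hXt t) fun i j => (abs_apply_le_specNorm _ i j).trans (hQK t).1)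
      (fun i j => abs_mul_apply_le (hXt t)
        (fun i j => (abs_apply_le_specNorm _ i j).trans (hQK t).2) j i) i j
  have hN' : (0 : ℝ) < N := by exact_mod_cast hN
  let ε : ℝ := min (Real.exp (-S) / (N * Real.exp S)) (1 / 2)
  have hε0 : 0 < ε := lt_min (by positivity) (by norm_num)
  have hε1 : ε ≤ 1 / 2 := min_le_right _ _
  have hAε : ∀ t i j, E j i → ε ≤ A t i j := fun t i j hij => by
    rw [hA]
    exact (min_le_left _ _).trans (le_maskedAttn E hloop _ (hS t) hij)
  refine ⟨ε, hε0, hAε, √(N * d) * (d * (2 * K * 2 * max B 1)) + 1, by positivity, fun t => ?_⟩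
  have hb : 0 ≤ 1 - ε ^ r := sub_nonneg.2 (pow_le_one₀ hε0.le (by linarith))
  have hband : ∀ j, InBand (fun i => Y t i j) (2 * K * (1 - ε ^ r) ^ (t / r)) := fun j =>
    InBand.iterate (y := fun t i => Y t i j) hε0.le hA0 hA1 hAε
      (fun t i => by simp only [hY, Matrix.mul_apply]) hv
      ⟨-K, fun i => ⟨(abs_le.1 (hYK 0 i j)).1, by linarith [(abs_le.1 (hYK 0 i j)).2]⟩⟩ t
  have hdiff : ∀ i i' k, |X t i k - X t i' k| ≤
      d * (2 * K * (1 - ε ^ r) ^ (t / r) * max B 1) := fun i i' k => by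
    have h := abs_mul_apply_le (P := Matrix.of fun (_ : Fin 1) j => Y t i j - Y t i' j)
      (fun _ j => (hband j).abs_sub_le i i') (hW t) 0 k
    simpa [hXY t, Matrix.mul_apply, sub_mul, Finset.sum_sub_distrib] using h
  have hB1 : 0 ≤ max B 1 := zero_le_one.trans (le_max_right _ _)
  set ρ := (1 - ε ^ r) ^ ((t : ℝ) / (r : ℝ))
  have hρ : 0 ≤ ρ := Real.rpow_nonneg hb _
  calc muMeasure (X t) ≤ √(N * d) * (d * (2 * K * (1 - ε ^ r) ^ (t / r) * max B 1)) :=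
        muMeasure_le hN _ (by positivity) hdiff
    _ ≤ √(N * d) * (d * (2 * K * (2 * ρ) * max B 1)) := by
        gcongr
        exact one_sub_pow_div_le hε0 hε1 r t
    _ ≤ (√(N * d) * (d * (2 * K * 2 * max B 1)) + 1) * ρ := by linarith
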